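/- arXiv:2605.19097 — 2 statements merged into one kernel-verified Lean document; each statement's English description precedes it below -/
import Mathlib

section
/- Let S = (G(V,E), (S_e)_{e∈E}) be a graph-directed IFS in ℝ^d with every S_e injective, satisfying the open set condition, with attractor (A_1,…,A_n). Then S_e(A_i°) ∩ S_{e'}(A_j°) = ∅ for all i, j, k ∈ V, e ∈ E_{k,i}, e' ∈ E_{k,j} with e ≠ e', where A° denotes the topological interior. -/
open Set Metric Topology Function

open MeasureTheory

section NormedSpace

variable {E : Type*} [NormedAddCommGroup E] [NormedSpace ℝ E] [FiniteDimensional ℝ E]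

lemma ContinuousLinearMap.det_one_add_pos_of_norm_lt_one {M : E →L[ℝ] E} (hM : ‖M‖ < 1) :
    0 < (1 + M).det := by
  have := FiniteDimensional.complete ℝ E
  have hcont : Continuous fun s : ℝ => (1 + s • M).det :=
    ContinuousLinearMap.continuous_det.comp (by fun_prop)
  have hne : ∀ s ∈ Icc (0 : ℝ) 1, (1 + s • M).det ≠ 0 := by
    intro s hs
    have hu : IsUnit (1 - -(s • M)) := by
      apply isUnit_one_sub_of_norm_lt_one
      rw [norm_neg, norm_smul, Real.norm_of_nonneg hs.1]
      nlinarith [norm_nonneg M, hs.2]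
    rw [sub_neg_eq_add] at hu
    have := (hu.map (ContinuousLinearMap.toLinearMapRingHom : (E →L[ℝ] E) →+* _)).map
      (LinearMap.det : (E →ₗ[ℝ] E) →* ℝ)
    exact this.ne_zero
  by_contra! hneg
  have hmem : (0 : ℝ) ∈ Icc ((1 + (1 : ℝ) • M).det) ((1 + (0 : ℝ) • M).det) := by
    constructor
    · simpa using hneg
    · simp [ContinuousLinearMap.det]
  obtain ⟨s, hs, h0⟩ := intermediate_value_Icc' zero_le_one hcont.continuousOn hmem
  exact hne s hs h0

lemma ContinuousLinearMap.exists_det_one_add_eq_sum {δ : ℝ} (hδ : 0 < δ) :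
    ∃ (s : Finset ℝ) (w : ℝ → ℝ), (∀ t ∈ s, t ∈ Ioo 0 δ) ∧
      ∀ M : E →L[ℝ] E, (1 + M).det = ∑ t ∈ s, w t * (1 + t • M).det := by
  obtain ⟨s, hs, hcard⟩ := (Ioo_infinite hδ).exists_subset_card_eq (Module.finrank ℝ E + 1)
  refine ⟨s, fun t => (Lagrange.basis s id t).eval 1, fun t ht => hs ht, fun M => ?_⟩
  let b := Module.finBasis ℝ E
  let N := LinearMap.toMatrix b b M
  let p : Polynomial ℝ :=
    ((Polynomial.X : Polynomial ℝ) • N.map Polynomial.C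
      + (1 : Matrix _ _ ℝ).map Polynomial.C).det
  have heval : ∀ t : ℝ, p.eval t = (1 + t • M).det := by
    intro t
    rw [ContinuousLinearMap.det, ← LinearMap.det_toMatrix b, ← Polynomial.coe_evalRingHom,
      RingHom.map_det]
    congr 1
    ext i j
    simp [N, Matrix.one_apply, LinearMap.toMatrix_apply, Finsupp.single_apply, eq_comm]
    split_ifs <;> simp [mul_comm, add_comm]
  have hdeg : p.degree < s.card := by
    refine (Polynomial.degree_le_natDegree).trans_lt ?_
    have := Polynomial.natDegree_det_X_add_C_le N 1
    rw [Fintype.card_fin] at this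
    rw [hcard]
    exact_mod_cast Nat.lt_succ_of_le this
  have := congrArg (Polynomial.eval 1) (Lagrange.eq_interpolate (injOn_id _) hdeg)
  rw [heval, one_smul, Lagrange.interpolate_apply, Polynomial.eval_finsetSum] at this
  simpa [heval, mul_comm] using this

omit [FiniteDimensional ℝ E] in
lemma lipschitzWith_indicator_closedBall {F : Type*} [NormedAddCommGroup F] {g : E → F} {L : NNReal}
    (hL : LipschitzOnWith L g (closedBall 0 1)) (hg : ∀ x ∈ sphere (0 : E) 1, g x = 0) :
    LipschitzWith L ((closedBall 0 1).indicator g) := by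
  have key : ∀ x ∈ closedBall (0 : E) 1, ∀ y ∉ closedBall (0 : E) 1,
      ‖g x‖ ≤ L * dist x y := by
    intro x hx y hy
    obtain ⟨z, hz, hz1⟩ : ∃ z ∈ segment ℝ x y, ‖z‖ = 1 := by
      refine (convex_segment x y).isPreconnected.intermediate_value
        (left_mem_segment ℝ x y) (right_mem_segment ℝ x y) continuous_norm.continuousOn
        ⟨by simpa using hx, ?_⟩
      simp at hy
      exact hy.le
    have h1 := hL.dist_le_mul x hx z (by simp [hz1])
    rw [hg z (by simp [hz1]), dist_zero_right] at h1
    have h2 := dist_add_dist_of_mem_segment hz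
    refine h1.trans (mul_le_mul_of_nonneg_left ?_ L.2)
    linarith [dist_nonneg (x := z) (y := y)]
  refine LipschitzWith.of_dist_le_mul fun x y => ?_
  by_cases hx : x ∈ closedBall (0 : E) 1 <;> by_cases hy : y ∈ closedBall (0 : E) 1
  · simpa only [indicator_of_mem, hx, hy] using hL.dist_le_mul x hx y hy
  · simpa only [indicator_of_mem, indicator_of_notMem, hx, hy, not_false_eq_true,
      dist_zero_right] using key x hx y hy
  · rw [dist_comm x y]
    simpa only [indicator_of_mem, indicator_of_notMem, hx, hy, not_false_eq_true,
      dist_zero_left] using key y hy x hx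
  · simp only [indicator_of_notMem, hx, hy, not_false_eq_true, dist_self]
    positivity

/-- A perturbation of the identity with small Lipschitz constant is bijective. -/
lemma LipschitzWith.bijective_add {φ : E → E} {K : NNReal} (hφ : LipschitzWith K φ)
    (hK : K < 1) : Bijective fun x => x + φ x := by
  have := FiniteDimensional.complete ℝ E
  constructor
  · intro x y hxy
    by_contra hne
    have h1 := hφ.dist_le_mul x y
    have h2 : dist (φ x) (φ y) = dist x y := by
      rw [dist_eq_norm, dist_eq_norm, ← norm_neg]
      congr 1
      have : x + φ x = y + φ y := hxy
      rw [neg_sub, sub_eq_sub_iff_add_eq_add, add_comm, ← this, add_comm]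
    have h3 : (K : ℝ) < 1 := hK
    nlinarith [dist_pos.2 hne]
  · intro y
    have hc : ContractingWith K fun x => y - φ x := by
      refine ⟨hK, LipschitzWith.of_dist_le_mul fun a b => ?_⟩
      rw [dist_sub_left]
      exact hφ.dist_le_mul a b
    refine ⟨hc.fixedPoint, ?_⟩
    have h : y - φ hc.fixedPoint = hc.fixedPoint := hc.fixedPoint_isFixedPt
    show hc.fixedPoint + φ hc.fixedPoint = y
    nth_rewrite 1 [← h]
    abel

end NormedSpace

section InnerProduct

variable {E : Type*} [NormedAddCommGroup E] [InnerProductSpace ℝ E] [FiniteDimensional ℝ E]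

lemma det_fderiv_eq_zero_of_norm_eq_one {r : E → E} (hr : Differentiable ℝ r)
    (hnorm : ∀ x, ‖r x‖ = 1) (x : E) : (fderiv ℝ r x).det = 0 := by
  by_contra hdet
  have hconst : HasFDerivAt (fun y => ‖r y‖ ^ 2) (0 : E →L[ℝ] ℝ) x := by
    simpa [hnorm] using hasFDerivAt_const (𝕜 := ℝ) (1 : ℝ) x
  have h := (hr x).hasFDerivAt.norm_sq.unique hconst
  let e := (fderiv ℝ r x).toContinuousLinearEquivOfDetNeZero hdet
  have he : fderiv ℝ r x (e.symm (r x)) = r x := e.apply_symm_apply (r x)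
  have h2 := DFunLike.congr_fun h (e.symm (r x))
  simp [he, hnorm] at h2

theorem not_contDiff_retraction_sphere {r : E → E} (hr : ContDiff ℝ 1 r)
    (hnorm : ∀ x, ‖r x‖ = 1) (hfix : ∀ x ∈ sphere (0 : E) 1, r x = x) : False := by
  let : MeasurableSpace E := borel E
  have : BorelSpace E := ⟨rfl⟩
  let μ : Measure E := Measure.addHaar
  let B := closedBall (0 : E) 1
  have hB : IsCompact B := isCompact_closedBall 0 1
  have hr' : Differentiable ℝ r := hr.differentiable one_ne_zero
  let g : E → E := fun x => r x - x
  have hg : ContDiff ℝ 1 g := hr.sub contDiff_id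
  have hg' : ∀ x, HasFDerivAt g (fderiv ℝ g x) x := fun x =>
    (hg.differentiable one_ne_zero x).hasFDerivAt
  have hgr : ∀ x, 1 + fderiv ℝ g x = fderiv ℝ r x := by
    intro x
    have : fderiv ℝ g x = fderiv ℝ r x - ContinuousLinearMap.id ℝ E :=
      ((hr' x).hasFDerivAt.sub (hasFDerivAt_id x)).fderiv
    rw [this]
    exact add_sub_cancel _ _
  have hfc : Continuous (fderiv ℝ g) := hg.continuous_fderiv one_ne_zero
  obtain ⟨L, hL⟩ := hg.contDiffOn.exists_lipschitzOnWith one_ne_zero (convex_closedBall 0 1) hB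
  have hL' := lipschitzWith_indicator_closedBall hL fun x hx => sub_eq_zero.2 (hfix x hx)
  obtain ⟨C, hC⟩ := hB.exists_bound_of_continuousOn hfc.continuousOn
  have hC0 : 0 ≤ C := (norm_nonneg _).trans (hC 0 (mem_closedBall_self zero_le_one))
  have hcont : ∀ t : ℝ, Continuous fun x => (1 + t • fderiv ℝ g x).det := fun t =>
    ContinuousLinearMap.continuous_det.comp (by fun_prop)
  have hsmall : ∀ t ∈ Ioo (0 : ℝ) (1 / (C + L + 1)),
      ∫ x in B, (1 + t • fderiv ℝ g x).det ∂μ = μ.real B := by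
    intro t ht
    have hpos : 0 < C + L + 1 := by positivity
    have ht1 : t * (C + L + 1) < 1 := (lt_div_iff₀ hpos).1 ht.2
    have hlip : LipschitzWith (t.toNNReal * L) fun x => t • B.indicator g x := by
      refine LipschitzWith.of_dist_le_mul fun x y => ?_
      rw [dist_smul₀, Real.norm_of_nonneg ht.1.le, NNReal.coe_mul, Real.coe_toNNReal t ht.1.le,
        mul_assoc]
      exact mul_le_mul_of_nonneg_left (hL'.dist_le_mul x y) ht.1.le
    have hbij := hlip.bijective_add (by
      rw [← NNReal.coe_lt_coe, NNReal.coe_mul, Real.coe_toNNReal t ht.1.le, NNReal.coe_one]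
      nlinarith [ht.1])
    have hin : ∀ x ∈ B, x + t • B.indicator g x = x + t • g x := fun x hx => by
      rw [indicator_of_mem hx]
    have himg : (fun x => x + t • g x) '' B = B := by
      apply Subset.antisymm
      · rintro _ ⟨x, hx, rfl⟩
        have : x + t • g x = (1 - t) • x + t • r x := by simp only [g]; module
        have ht2 : t ≤ 1 := by nlinarith [ht.1, L.2]
        show x + t • g x ∈ B
        rw [this]
        exact convex_closedBall (0 : E) 1 hx (by simp [hnorm]) (by linarith) ht.1.le (by ring)
      · intro y hy
        obtain ⟨x, hx⟩ := hbij.2 y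
        have hxB : x ∈ B := by
          by_contra hxB
          simp only [indicator_of_notMem hxB, smul_zero, add_zero] at hx
          exact hxB (hx ▸ hy)
        exact ⟨x, hxB, by rw [← hx]; exact (hin x hxB).symm⟩
    have hinj : InjOn (fun x => x + t • g x) B := fun x hx y hy hxy =>
      hbij.1 (by simpa only [hin x hx, hin y hy] using hxy)
    have hder : ∀ x ∈ B, HasFDerivWithinAt (fun x => x + t • g x) (1 + t • fderiv ℝ g x) B x :=
      fun x _ => ((hasFDerivAt_id x).add ((hg' x).const_smul t)).hasFDerivWithinAt
    have := integral_image_eq_integral_abs_det_fderiv_smul μ hB.measurableSet hder hinj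
      fun _ => (1 : ℝ)
    rw [himg] at this
    simp only [integral_const, smul_eq_mul, mul_one, measureReal_restrict_apply_univ] at this
    rw [this]
    refine setIntegral_congr_fun hB.measurableSet fun x hx => (abs_of_pos ?_).symm
    apply ContinuousLinearMap.det_one_add_pos_of_norm_lt_one
    rw [norm_smul, Real.norm_of_nonneg ht.1.le]
    nlinarith [hC x hx, ht.1, L.2]
  obtain ⟨s, w, hs, hw⟩ := ContinuousLinearMap.exists_det_one_add_eq_sum (E := E)
    (δ := 1 / (C + L + 1)) (by positivity)
  have hw1 : ∑ t ∈ s, w t = 1 := by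
    have h1 : (1 : E →L[ℝ] E).det = 1 := LinearMap.det_id
    have h0 := hw 0
    simp only [smul_zero, add_zero, h1, mul_one] at h0
    exact h0.symm
  have hzero : ∫ x in B, (1 + fderiv ℝ g x).det ∂μ = 0 := by
    simp_rw [hgr, det_fderiv_eq_zero_of_norm_eq_one hr' hnorm, integral_zero]
  have hone : ∫ x in B, (1 + fderiv ℝ g x).det ∂μ = μ.real B := by
    rw [funext fun x => hw (fderiv ℝ g x)]
    rw [integral_finsetSum _ fun t _ =>
      (((hcont t).const_mul _).continuousOn.integrableOn_compact hB)]
    simp_rw [integral_const_mul]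
    rw [Finset.sum_congr rfl fun t ht => by rw [hsmall t (hs t ht)], ← Finset.sum_mul, hw1,
      one_mul]
  have hpos : 0 < μ.real B := ENNReal.toReal_pos
    (measure_closedBall_pos μ 0 one_pos).ne' hB.measure_lt_top.ne
  linarith

/-- A continuous map on the closed unit ball that is close to the identity has a zero. -/
theorem exists_eq_zero_of_norm_sub_id_le {f : E → E} (hf : ContinuousOn f (closedBall 0 1))
    (hid : ∀ x ∈ closedBall (0 : E) 1, ‖f x - x‖ ≤ 1 / 4) :
    ∃ x ∈ closedBall (0 : E) 1, f x = 0 := by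
  obtain ⟨h, hhf⟩ := ContinuousMap.exists_restrict_eq isClosed_closedBall
    (⟨(closedBall (0 : E) 1).domRestrict f, hf.domRestrict⟩ : C(closedBall (0 : E) 1, E))
  have hfh : ∀ x ∈ closedBall (0 : E) 1, f x = h x := fun x hx =>
    (DFunLike.congr_fun hhf ⟨x, hx⟩).symm
  have hh := h.continuous
  by_contra! hne
  replace hne : ∀ x ∈ closedBall (0 : E) 1, h x ≠ 0 := fun x hx => hfh x hx ▸ hne x hx
  replace hid : ∀ x ∈ closedBall (0 : E) 1, ‖h x - x‖ ≤ 1 / 4 := fun x hx => hfh x hx ▸ hid x hx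
  obtain ⟨δ, hδ, hδh⟩ : ∃ δ > 0, ∀ x ∈ closedBall (0 : E) 1, δ ≤ ‖h x‖ := by
    obtain ⟨x₀, hx₀, hmin⟩ := (isCompact_closedBall (0 : E) 1).exists_isMinOn
      ⟨0, mem_closedBall_self zero_le_one⟩ hh.norm.continuousOn
    exact ⟨‖h x₀‖, norm_pos_iff.2 (hne x₀ hx₀), fun x hx => hmin hx⟩
  obtain ⟨k, hk, hkh, -⟩ := hh.exists_contDiff_approx 1 (ε := fun _ => min δ (1 / 8))
    continuous_const fun _ => by positivity
  let χ : ContDiffBump (0 : E) := ⟨1 / 2, 1, by norm_num, by norm_num⟩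
  let m : E → E := fun x => x + χ x • (k x - x)
  have hm : ContDiff ℝ 1 m := contDiff_id.add (χ.contDiff.smul (hk.sub contDiff_id))
  have hout : ∀ x, 1 ≤ ‖x‖ → m x = x := by
    intro x hx
    have : χ x = 0 := χ.zero_of_le_dist (by simpa [χ] using hx)
    simp [m, this]
  have hm0 : ∀ x, m x ≠ 0 := by
    intro x hx
    rcases le_total 1 ‖x‖ with h1 | h1
    · rw [hout x h1] at hx
      rw [hx, norm_zero] at h1
      linarith
    have hxB : x ∈ closedBall (0 : E) 1 := by simpa using h1
    have hkx := hkh x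
    rw [dist_eq_norm] at hkx
    rcases le_total ‖x‖ (1 / 2) with h2 | h2
    · have hχ : χ x = 1 := χ.one_of_mem_closedBall (by simpa [χ] using h2)
      have hk0 : k x = 0 := by simpa [m, hχ] using hx
      rw [hk0, zero_sub, norm_neg] at hkx
      linarith [hδh x hxB, min_le_left δ (1 / 8)]
    · have h3 : ‖x‖ ≤ ‖k x - x‖ := by
        rw [eq_neg_of_add_eq_zero_left hx, norm_neg, norm_smul, Real.norm_of_nonneg χ.nonneg,
          ← eq_neg_of_add_eq_zero_left hx]
        exact mul_le_of_le_one_left (norm_nonneg _) χ.le_one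
      have h4 : ‖k x - x‖ ≤ ‖k x - h x‖ + ‖h x - x‖ := norm_sub_le_norm_sub_add_norm_sub _ _ _
      linarith [hid x hxB, min_le_right δ (1 / 8)]
  refine not_contDiff_retraction_sphere (r := fun x => ‖m x‖⁻¹ • m x)
    (((hm.norm ℝ hm0).inv fun x => norm_ne_zero_iff.2 (hm0 x)).smul hm)
    (fun x => by simp [norm_smul, hm0 x]) fun x hx => ?_
  have hx1 : ‖x‖ = 1 := by simpa using hx
  simp [hout x hx1.ge, hx1]

/-- If `c ∉ K`, and a continuous map `G` is small on a ball around `c` and has no zeros in `K`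
outside of this ball, then `G` can be perturbed on `K` so as to have no zeros there. -/
theorem exists_continuous_near_ne_zero {K : Set E} (hK : IsCompact K) {G : E → E}
    (hG : Continuous G) {c : E} (hc : c ∉ K) {ε η : ℝ} (hε : 0 < ε) (hη : 0 < η)
    (hG0 : ∀ y ∈ K, ε ≤ dist y c → G y ≠ 0) (hGc : ∀ y ∈ closedBall c ε, ‖G y‖ ≤ η) :
    ∃ F : E → E, ContinuousOn F K ∧ ∀ y ∈ K, F y ≠ 0 ∧ ‖F y - G y‖ ≤ 4 * η := by
  let : MeasurableSpace E := borel E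
  have : BorelSpace E := ⟨rfl⟩
  let μ : Measure E := Measure.addHaar
  obtain ⟨δ, hδ, hδG⟩ : ∃ δ > 0, ∀ y ∈ K, ε ≤ dist y c → δ ≤ ‖G y‖ := by
    have hcp : IsCompact (K ∩ {y | ε ≤ dist y c}) :=
      hK.inter_right (isClosed_le continuous_const (by fun_prop))
    rcases (K ∩ {y | ε ≤ dist y c}).eq_empty_or_nonempty with he | hne
    · refine ⟨1, one_pos, fun y hy hyc => ?_⟩
      exact absurd (show y ∈ K ∩ {y | ε ≤ dist y c} from ⟨hy, hyc⟩) (by simp [he])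
    · obtain ⟨y₀, hy₀, hmin⟩ := hcp.exists_isMinOn hne hG.norm.continuousOn
      exact ⟨‖G y₀‖, norm_pos_iff.2 (hG0 y₀ hy₀.1 hy₀.2), fun y hy hyc => hmin ⟨hy, hyc⟩⟩
  have hκ : 0 < min (δ / 2) η := by positivity
  obtain ⟨P, hP, hPG, -⟩ := hG.exists_contDiff_approx 1 (ε := fun _ => min (δ / 2) η)
    continuous_const fun _ => hκ
  have hnull : μ (P '' sphere c ε) = 0 :=
    addHaar_image_eq_zero_of_differentiableOn_of_addHaar_eq_zero μ
      (hP.differentiable one_ne_zero).differentiableOn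
      (Measure.addHaar_sphere_of_ne_zero μ c hε.ne')
  have hdense : Dense (P '' sphere c ε)ᶜ := by
    rw [← interior_eq_empty_iff_dense_compl]
    exact μ.interior_eq_empty_of_null hnull
  obtain ⟨v, hv, hvs⟩ := hdense.exists_dist_lt 0 hκ
  rw [dist_zero_left] at hvs
  let Φ : E → E := fun y => c + max (ε / dist y c) 1 • (y - c)
  have hdist : ∀ y ∈ K, dist y c ≠ 0 := fun y hy => dist_ne_zero.2 (ne_of_mem_of_not_mem hy hc)
  have hΦ : ContinuousOn Φ K :=
    continuousOn_const.add ((((continuousOn_const.div (by fun_prop) hdist).sup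
      continuousOn_const)).smul (by fun_prop))
  have hfar : ∀ y ∈ K, ε ≤ dist y c → Φ y = y := by
    intro y hy hyc
    have : ε / dist y c ≤ 1 := (div_le_one (hε.trans_le hyc)).2 hyc
    simp [Φ, max_eq_right this]
  have hnear : ∀ y ∈ K, dist y c ≤ ε → Φ y ∈ sphere c ε := by
    intro y hy hyc
    have hpos : 0 < dist y c := dist_nonneg.lt_of_ne' (hdist y hy)
    have : 1 ≤ ε / dist y c := (one_le_div hpos).2 hyc
    rw [mem_sphere, dist_eq_norm]
    simp only [Φ, max_eq_left this, add_sub_cancel_left, norm_smul]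
    rw [← dist_eq_norm, Real.norm_of_nonneg (by positivity), div_mul_cancel₀ _ hpos.ne']
  refine ⟨fun y => P (Φ y) - v, (hP.continuous.comp_continuousOn hΦ).sub continuousOn_const,
    fun y hy => ?_⟩
  show P (Φ y) - v ≠ 0 ∧ ‖P (Φ y) - v - G y‖ ≤ 4 * η
  have hPy := hPG (Φ y)
  rw [dist_eq_norm] at hPy
  have hκ1 := min_le_left (δ / 2) η
  have hκ2 := min_le_right (δ / 2) η
  rcases le_total ε (dist y c) with hyc | hyc
  · rw [hfar y hy hyc] at hPy ⊢
    have h1 : ‖P y - v - G y‖ ≤ ‖P y - G y‖ + ‖v‖ := by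
      rw [sub_right_comm]
      exact norm_sub_le _ _
    refine ⟨fun h0 => ?_, by linarith⟩
    rw [h0, zero_sub, norm_neg] at h1
    linarith [hδG y hy hyc]
  · have hs := hnear y hy hyc
    refine ⟨fun h0 => hv ⟨Φ y, hs, sub_eq_zero.1 h0⟩, ?_⟩
    have h1 : P (Φ y) - v - G y = (P (Φ y) - G (Φ y)) - v + G (Φ y) - G y := by abel
    have h2 := norm_sub_le ((P (Φ y) - G (Φ y)) - v + G (Φ y)) (G y)
    have h3 := norm_add_le ((P (Φ y) - G (Φ y)) - v) (G (Φ y))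
    have h4 := norm_sub_le (P (Φ y) - G (Φ y)) v
    rw [h1]
    linarith [hGc _ (sphere_subset_closedBall hs), hGc y hyc]

lemma mem_interior_image_closedBall {f : E → E} (hf : Continuous f) (hinj : Injective f) :
    f 0 ∈ interior (f '' closedBall 0 1) := by
  set B := closedBall (0 : E) 1 with hBdef
  have hB : IsCompact B := isCompact_closedBall 0 1
  have hK : IsCompact (f '' B) := hB.image hf
  have hemb : IsClosedEmbedding (B.domRestrict f) := by
    have : CompactSpace B := isCompact_iff_compactSpace.1 hB
    exact (hf.comp continuous_subtype_val).isClosedEmbedding (hinj.comp Subtype.val_injective)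
  obtain ⟨G, hG⟩ := ContinuousMap.exists_extension' hemb
    (⟨Subtype.val, continuous_subtype_val⟩ : C(B, E))
  have hGf : ∀ x ∈ B, G (f x) = x := fun x hx => congrFun hG ⟨x, hx⟩
  have h0 : G (f 0) = 0 := hGf 0 (mem_closedBall_self zero_le_one)
  obtain ⟨ε, hε, hGε⟩ := Metric.continuous_iff.1 G.continuous (f 0) (1 / 16) (by norm_num)
  by_contra hnot
  rw [← mem_compl_iff, ← closure_compl, Metric.mem_closure_iff] at hnot
  obtain ⟨c, hc, hcε⟩ := hnot (ε / 2) (by positivity)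
  obtain ⟨F, hF, hF0⟩ := exists_continuous_near_ne_zero hK G.continuous hc
    (ε := ε / 2) (η := 1 / 16) (by positivity) (by norm_num) (by
      rintro _ ⟨x, hx, rfl⟩ hxc hx0
      rw [hGf x hx] at hx0
      rw [hx0] at hxc
      linarith) (by
      intro y hy
      have hd : dist y (f 0) < ε := by
        have := dist_triangle_right y (f 0) c
        linarith [mem_closedBall.1 hy]
      have := hGε y hd
      rw [h0, dist_zero_right] at this
      exact this.le)
  obtain ⟨x, hx, hx0⟩ := exists_eq_zero_of_norm_sub_id_le (f := F ∘ f)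
    (hF.comp hf.continuousOn (mapsTo_image f B)) fun x hx => by
      have := (hF0 _ (mem_image_of_mem f hx)).2
      rw [hGf x hx] at this
      exact this.trans (by norm_num)
  exact (hF0 _ (mem_image_of_mem f hx)).1 hx0

/-- **Invariance of domain** for globally defined maps. -/
theorem Continuous.isOpenMap_of_injective {f : E → E} (hf : Continuous f) (hinj : Injective f) :
    IsOpenMap f := by
  refine isOpenMap_iff_nhds_le.2 fun x s hs => ?_
  obtain ⟨ρ, hρ, hρs⟩ := Metric.nhds_basis_closedBall.mem_iff.1 (Filter.mem_map.1 hs)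
  have h := mem_interior_image_closedBall (f := fun z => f (x + ρ • z)) (by fun_prop)
    fun a b hab => smul_right_injective E hρ.ne' (add_left_cancel (hinj hab))
  rw [smul_zero, add_zero] at h
  refine Filter.mem_of_superset (mem_interior_iff_mem_nhds.1 h) ?_
  rintro _ ⟨z, hz, rfl⟩
  refine hρs ?_
  rw [mem_closedBall_zero_iff] at hz
  rw [mem_closedBall, dist_self_add_left, norm_smul, Real.norm_of_nonneg hρ.le]
  exact mul_le_of_le_one_right hρ.le hz

end InnerProduct

/-- Each compact piece of a graph-directed attractor lies in the closure of any nonempty set of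
a family that is mapped into itself. -/
lemma subset_closure_of_graphDirected {X V E : Type*} [PseudoMetricSpace X] [Finite V]
    {src tgt : E → V} {S : E → X → X}
    (hcontr : ∀ e : E, ∃ r : NNReal, r < 1 ∧ LipschitzWith r (S e))
    {O A : V → Set X} (hO : ∀ k, (O k).Nonempty) (hOsub : ∀ e, S e '' O (tgt e) ⊆ O (src e))
    (hA : ∀ i, IsCompact (A i))
    (hattr : ∀ i, A i ⊆ ⋃ (e : E) (_ : src e = i), S e '' A (tgt e)) (i : V) :
    A i ⊆ closure (O i) := by
  have hcp : IsCompact (⋃ k, Sigma.mk k '' A k) :=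
    isCompact_iUnion fun k => (hA k).image continuous_sigmaMk
  let φ : (Σ _ : V, X) → ℝ := fun p => infDist p.2 (O p.1)
  have hφ : Continuous φ := continuous_sigma fun k => continuous_infDist_pt (O k)
  intro x hx
  have hmem : ∀ {k y}, y ∈ A k → (⟨k, y⟩ : Σ _ : V, X) ∈ ⋃ k, Sigma.mk k '' A k :=
    fun {k y} hy => mem_iUnion.2 ⟨k, y, hy, rfl⟩
  obtain ⟨p, hp, hmax⟩ := hcp.exists_isMaxOn ⟨_, hmem hx⟩ hφ.continuousOn
  obtain ⟨k, y, hy, rfl⟩ := mem_iUnion.1 hp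
  have hle : ∀ {j z}, z ∈ A j → infDist z (O j) ≤ infDist y (O k) := fun hz => hmax (hmem hz)
  obtain ⟨e, rfl, y', hy', rfl⟩ : ∃ e, src e = k ∧ y ∈ S e '' A (tgt e) := by
    simpa using hattr k hy
  obtain ⟨r, hr1, hr⟩ := hcontr e
  have hcontract : infDist (S e y') (O (src e)) ≤ r * infDist y' (O (tgt e)) := by
    refine le_of_forall_pos_le_add fun ε hε => ?_
    obtain ⟨o, ho, hdist⟩ := (infDist_lt_iff (hO (tgt e))).1
      (lt_add_of_pos_right (infDist y' (O (tgt e))) hε)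
    have h1 := infDist_le_dist_of_mem (x := S e y') (hOsub e (mem_image_of_mem _ ho))
    have h2 := hr.dist_le_mul y' o
    have h3 : (r : ℝ) ≤ 1 := hr1.le
    nlinarith [r.2]
  have hr1' : (r : ℝ) < 1 := hr1
  have hzero : infDist (S e y') (O (src e)) ≤ 0 := by
    nlinarith [hle hy', r.2, infDist_nonneg (x := S e y') (s := O (src e))]
  rw [mem_closure_iff_infDist_zero (hO i)]
  exact le_antisymm ((hle hx).trans hzero) infDist_nonneg

theorem interiors_of_pieces_disjoint_of_OSC
    (d n : ℕ) (E : Type) [Fintype E] (src tgt : E → Fin n)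
    (S : E → EuclideanSpace ℝ (Fin d) → EuclideanSpace ℝ (Fin d))
    (hout : ∀ i : Fin n, ∃ e : E, src e = i)
    -- each `S e` is an injective contraction
    (hinj : ∀ e, Function.Injective (S e))
    (hcontr : ∀ e : E, ∃ r : NNReal, r < 1 ∧ LipschitzWith r (S e))
    -- the open set condition
    (O : Fin n → Set (EuclideanSpace ℝ (Fin d)))
    (hOne : ∀ k, (O k).Nonempty) (hOopen : ∀ k, IsOpen (O k))
    (hObdd : ∀ k, Bornology.IsBounded (O k))
    (hOsub : ∀ i, (⋃ (e : E) (_ : src e = i), S e '' O (tgt e)) ⊆ O i)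
    (hOdisj : ∀ e e' : E, src e = src e' → e ≠ e' →
      Disjoint (S e '' O (tgt e)) (S e' '' O (tgt e')))
    -- the attractor
    (A : Fin n → Set (EuclideanSpace ℝ (Fin d)))
    (hAcp : ∀ i, IsCompact (A i)) (hAne : ∀ i, (A i).Nonempty)
    (hattr : ∀ i, A i = ⋃ (e : E) (_ : src e = i), S e '' A (tgt e)) :
    ∀ e e' : E, src e = src e' → e ≠ e' →
      S e '' interior (A (tgt e)) ∩ S e' '' interior (A (tgt e')) = ∅ := by
  intro e e' hee hne
  have hcont : ∀ e, Continuous (S e) := fun e => let ⟨_, _, hr⟩ := hcontr e; hr.continuous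
  have hopen : ∀ e, IsOpenMap (S e) := fun e => (hcont e).isOpenMap_of_injective (hinj e)
  have hcl : ∀ e, S e '' interior (A (tgt e)) ⊆ closure (S e '' O (tgt e)) := fun e =>
    (image_mono (interior_subset.trans (subset_closure_of_graphDirected hcontr hOne
      (fun e => (subset_iUnion₂ (s := fun e' (_ : src e' = src e) => S e' '' O (tgt e'))
        e rfl).trans (hOsub (src e))) hAcp (fun i => (hattr i).subset) _))).trans
      (image_closure_subset_closure_image (hcont e))
  have hdisj : Disjoint (S e '' interior (A (tgt e))) (S e' '' interior (A (tgt e'))) := by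
    have h1 : Disjoint (S e '' O (tgt e)) (S e' '' interior (A (tgt e'))) :=
      ((hOdisj e e' hee hne).closure_right (hopen e _ (hOopen _))).mono_right (hcl e')
    exact (h1.closure_left (hopen e' _ isOpen_interior)).mono_left (hcl e)
  exact hdisj.inter_eq
end

section
/- Let S = (G(V,E), (S_e)_{e∈E}) be a strongly connected graph-directed IFS in ℝ² with all S_e injective contractions, satisfying the OSC, whose attractor components A_1,…,A_n are all connected and have nonempty interior with no holes. Then the boundary ∂A_i of each A_i is connected. -/
open Set Metric Topology Function

/-- A Jordan curve in the plane: a subset homeomorphic to the unit circle. -/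
def IsJordanCurve (J : Set (EuclideanSpace ℝ (Fin 2))) : Prop :=
  Nonempty (J ≃ₜ Metric.sphere (0 : EuclideanSpace ℝ (Fin 2)) 1)

/-- The interior region of a Jordan curve `J`: the union of the bounded connected
components of its complement. -/
def jordanInterior (J : Set (EuclideanSpace ℝ (Fin 2))) : Set (EuclideanSpace ℝ (Fin 2)) :=
  {x | x ∉ J ∧ Bornology.IsBounded (connectedComponentIn Jᶜ x)}

/-- A set `X ⊆ ℝ²` has no hole if every Jordan curve contained in `X` has its interior
region contained in `X`. -/
def HasNoHole (X : Set (EuclideanSpace ℝ (Fin 2))) : Prop :=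
  ∀ J : Set (EuclideanSpace ℝ (Fin 2)), J ⊆ X → IsJordanCurve J → jordanInterior J ⊆ X

/-- `IsPathFrom src tgt i j p` : the list of edges `p` is a directed path from `i` to `j`. -/
def IsPathFrom {n : ℕ} {E : Type*} (src tgt : E → Fin n) : Fin n → Fin n → List E → Prop
  | i, j, [] => i = j
  | i, j, e :: p => src e = i ∧ IsPathFrom src tgt (tgt e) j p

/-- The graph of unit grid edges separating two cells of `ℤ × ℤ` with different labels, where the
cell `(i, j)` is the unit square with lower left corner `(i, j)`. -/
def gridBoundary (R : ℤ × ℤ → ZMod 2) : SimpleGraph (ℤ × ℤ) :=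
  SimpleGraph.fromRel fun p q =>
    (q = (p.1, p.2 + 1) ∧ R p ≠ R (p.1 - 1, p.2)) ∨ (q = (p.1 + 1, p.2) ∧ R p ≠ R (p.1, p.2 - 1))

lemma gridBoundary_adj_vertical (R : ℤ × ℤ → ZMod 2) (i j : ℤ) :
    (gridBoundary R).Adj (i, j) (i, j + 1) ↔ R (i, j) ≠ R (i - 1, j) := by
  simp [gridBoundary, add_assoc]

lemma gridBoundary_adj_horizontal (R : ℤ × ℤ → ZMod 2) (i j : ℤ) :
    (gridBoundary R).Adj (i, j) (i + 1, j) ↔ R (i, j) ≠ R (i, j - 1) := by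
  simp [gridBoundary, add_assoc]

/-- Induction principle for adjacency in `gridBoundary R`. -/
lemma gridBoundary_adj_cases {R : ℤ × ℤ → ZMod 2} {P : ℤ × ℤ → ℤ × ℤ → Prop}
    (symm : ∀ p q, P p q → P q p)
    (vert : ∀ i j, R (i, j) ≠ R (i - 1, j) → P (i, j) (i, j + 1))
    (horiz : ∀ i j, R (i, j) ≠ R (i, j - 1) → P (i, j) (i + 1, j))
    {p q : ℤ × ℤ} (h : (gridBoundary R).Adj p q) : P p q := by
  obtain ⟨i, j⟩ := p
  obtain ⟨k, l⟩ := q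
  simp only [gridBoundary, SimpleGraph.fromRel_adj] at h
  obtain ⟨-, (⟨h, h'⟩ | ⟨h, h'⟩) | (⟨h, h'⟩ | ⟨h, h'⟩)⟩ := h
  · exact h ▸ vert _ _ h'
  · exact h ▸ horiz _ _ h'
  · exact symm _ _ (h ▸ vert _ _ h')
  · exact symm _ _ (h ▸ horiz _ _ h')

lemma gridBoundary_exists_adj_ne {R : ℤ × ℤ → ZMod 2} {p q : ℤ × ℤ}
    (h : (gridBoundary R).Adj p q) : ∃ q' ≠ q, (gridBoundary R).Adj p q' := by
  obtain ⟨i, j⟩ := p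
  have key : ∀ a b c d : ZMod 2, a ≠ b → b ≠ c ∨ c ≠ d ∨ d ≠ a := by decide
  have h1 := gridBoundary_adj_vertical R i j
  have h2 := gridBoundary_adj_horizontal R i j
  have h3 := gridBoundary_adj_vertical R i (j - 1)
  have h4 := gridBoundary_adj_horizontal R (i - 1) j
  rw [sub_add_cancel, SimpleGraph.adj_comm] at h3 h4
  have hq : q = (i, j + 1) ∨ q = (i + 1, j) ∨ q = (i, j - 1) ∨ q = (i - 1, j) := by
    simp only [gridBoundary, SimpleGraph.fromRel_adj] at h
    grind
  have e1 : ((i, j + 1) : ℤ × ℤ) ≠ (i, j - 1) := by grind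
  have e2 : ((i + 1, j) : ℤ × ℤ) ≠ (i - 1, j) := by grind
  have e3 : ((i, j + 1) : ℤ × ℤ) ≠ (i + 1, j) := by grind
  have e4 : ((i, j + 1) : ℤ × ℤ) ≠ (i - 1, j) := by grind
  have e5 : ((i, j - 1) : ℤ × ℤ) ≠ (i + 1, j) := by grind
  have e6 : ((i, j - 1) : ℤ × ℤ) ≠ (i - 1, j) := by grind
  have k1 := key (R (i, j)) (R (i - 1, j)) (R (i - 1, j - 1)) (R (i, j - 1))
  have k2 := key (R (i - 1, j)) (R (i - 1, j - 1)) (R (i, j - 1)) (R (i, j))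
  have k3 := key (R (i - 1, j - 1)) (R (i, j - 1)) (R (i, j)) (R (i - 1, j))
  have k4 := key (R (i, j - 1)) (R (i, j)) (R (i - 1, j)) (R (i - 1, j - 1))
  by_contra! hcon
  have c1 := hcon (i, j + 1)
  have c2 := hcon (i + 1, j)
  have c3 := hcon (i, j - 1)
  have c4 := hcon (i - 1, j)
  clear hcon key
  rcases hq with rfl | rfl | rfl | rfl <;> grind

/-- A discrete closed `1`-form on the grid has a primitive. -/
lemma exists_grid_primitive {v h : ℤ → ℤ → ZMod 2} {M : ℤ}
    (hv : ∀ i ≤ M, ∀ j, v i j = 0) (hh : ∀ i ≤ M, ∀ j, h i j = 0)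
    (hvh : ∀ i j, h i j + h (i - 1) j + v i j + v i (j - 1) = 0) :
    ∃ R : ℤ × ℤ → ZMod 2, (∀ i j, R (i, j) = R (i - 1, j) + v i j) ∧
      ∀ i j, R (i, j) = R (i, j - 1) + h i j := by
  have step : ∀ i j, (∑ k ∈ Finset.Ioc M i, v k j) = (∑ k ∈ Finset.Ioc M (i - 1), v k j) + v i j := by
    intro i j
    rcases le_or_gt i M with hi | hi
    · rw [Finset.Ioc_eq_empty (by lia), Finset.Ioc_eq_empty (by lia), hv i hi]; simp
    · have : Finset.Ioc M i = insert i (Finset.Ioc M (i - 1)) := by ext; simp; lia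
      rw [this, Finset.sum_insert (by simp), add_comm]
  refine ⟨fun p => ∑ k ∈ Finset.Ioc M p.1, v k p.2, step, fun i j => ?_⟩
  rcases le_or_gt i M with hi | hi
  · simp [Finset.Ioc_eq_empty (show ¬ M < i by lia), hh i hi]
  · induction i, hi.le using Int.leInduction with
    | base => lia
    | succ i hi ih =>
      have key : ∀ a b c d e f : ZMod 2, a + b + c + d = 0 → e = f + b → e + c = f + d + a := by
        decide
      have := hvh (i + 1) j
      have s1 := step (i + 1) j
      have s2 := step (i + 1) (j - 1)
      simp only [add_sub_cancel_right] at *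
      rw [s1, s2]
      refine key _ _ _ _ _ _ this ?_
      rcases (show M = i ∨ M < i by lia) with rfl | hi
      · simp [hh]
      · exact ih hi

/-- A nonempty finite graph without leaves contains a cycle. -/
lemma SimpleGraph.exists_isCycle_of_forall_exists_adj_ne {V : Type*} (G : SimpleGraph V)
    [Finite G.edgeSet] {a b : V} (hab : G.Adj a b)
    (hG : ∀ p q, G.Adj p q → ∃ q' ≠ q, G.Adj p q') : ∃ (u : V) (p : G.Walk u u), p.IsCycle := by
  by_contra! hcon
  have hac : G.IsAcyclic := hcon
  have : Nonempty V := ⟨a⟩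
  obtain ⟨u, v, p, hp, hmax⟩ := SimpleGraph.Walk.exists_isPath_forall_isPath_length_le_length G
  have hnil : ¬ p.Nil := by
    intro hn
    have h1 := hmax a b hab.toWalk (by simp [hab.ne])
    have h2 := SimpleGraph.Walk.length_eq_zero_iff.mpr hn
    simp at h1
    lia
  obtain ⟨w, hw, hadj⟩ := hG _ _ (p.adj_snd hnil)
  refine hw (hac.eq_snd_of_adj_start hp hadj ?_)
  by_contra hsupp
  have := hmax _ _ _ (hp.cons (h := hadj.symm) hsupp)
  simp at this

/-- A cycle in a grid graph is the full boundary of some labelling of the cells. -/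
lemma exists_gridBoundary_adj_iff_mem_edges {R : ℤ × ℤ → ZMod 2} {u : ℤ × ℤ}
    {p : (gridBoundary R).Walk u u} (hp : p.IsCycle) :
    ∃ R' : ℤ × ℤ → ZMod 2, ∀ x y, (gridBoundary R').Adj x y ↔ s(x, y) ∈ p.edges := by
  classical
  let v : ℤ → ℤ → ZMod 2 := fun i j => if s((i, j), (i, j + 1)) ∈ p.edges then 1 else 0
  let h : ℤ → ℤ → ZMod 2 := fun i j => if s((i, j), (i + 1, j)) ∈ p.edges then 1 else 0
  obtain ⟨M, hM⟩ : ∃ M : ℤ, ∀ x ∈ p.support, M < x.1 := by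
    obtain ⟨M, hM⟩ := (p.support.toFinset.image Prod.fst).bddBelow
    refine ⟨M - 1, fun x hx => ?_⟩
    have : M ≤ x.1 := hM (by
      simp only [Finset.coe_image, List.coe_toFinset, Set.mem_image]
      exact ⟨x, hx, rfl⟩)
    lia
  have hv : ∀ i ≤ M, ∀ j, v i j = 0 := fun i hi j => if_neg fun hmem =>
    (hM _ (p.fst_mem_support_of_mem_edges hmem)).not_ge hi
  have hh : ∀ i ≤ M, ∀ j, h i j = 0 := fun i hi j => if_neg fun hmem =>
    (hM _ (p.fst_mem_support_of_mem_edges hmem)).not_ge hi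
  have hvh : ∀ i j, h i j + h (i - 1) j + v i j + v i (j - 1) = 0 := by
    intro i j
    have hev := (hp.isTrail.even_countP_edges_iff (i, j)).2 (by simp)
    let T : Finset (Sym2 (ℤ × ℤ)) := {s((i, j), (i + 1, j)), s((i - 1, j), (i, j)),
      s((i, j), (i, j + 1)), s((i, j - 1), (i, j))}
    have hT : (p.edges.toFinset.filter fun e => (i, j) ∈ e) = T.filter (· ∈ p.edges) := by
      ext e
      simp only [Finset.mem_filter, List.mem_toFinset]
      refine ⟨fun ⟨he, hij⟩ => ⟨?_, he⟩, fun ⟨he, he'⟩ => ⟨he', ?_⟩⟩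
      · induction e with | _ x y =>
        have hadj := p.adj_of_mem_edges he
        simp only [gridBoundary, SimpleGraph.fromRel_adj] at hadj
        simp only [T, Finset.mem_insert, Finset.mem_singleton, Sym2.eq_iff]
        rw [Sym2.mem_iff] at hij
        grind
      · simp only [T, Finset.mem_insert, Finset.mem_singleton] at he
        rcases he with rfl | rfl | rfl | rfl <;> simp
    have hcard : (p.edges.countP fun e => (i, j) ∈ e) = (T.filter (· ∈ p.edges)).card := by
      rw [← hT, List.countP_eq_length_filter,
        ← List.toFinset_card_of_nodup (hp.isTrail.edges_nodup.filter _), List.toFinset_filter]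
      simp only [decide_eq_true_eq]
    have hsum : ((T.filter (· ∈ p.edges)).card : ZMod 2) = 0 := by
      rw [ZMod.natCast_eq_zero_iff_even, ← hcard]; exact hev
    rw [Finset.card_filter, Nat.cast_sum] at hsum
    rw [Finset.sum_insert, Finset.sum_insert, Finset.sum_insert, Finset.sum_singleton] at hsum
    · simp only [v, h, sub_add_cancel]
      push_cast at hsum
      rwa [add_assoc, add_assoc]
    all_goals simp
    all_goals lia
  obtain ⟨R', h1, h2⟩ := exists_grid_primitive hv hh hvh
  refine ⟨R', fun x y => ⟨fun hxy => ?_, fun hxy => ?_⟩⟩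
  · refine gridBoundary_adj_cases (P := fun x y => s(x, y) ∈ p.edges)
      (fun x y => by simp [Sym2.eq_swap]) (fun i j hij => ?_) (fun i j hij => ?_) hxy
    · by_contra hmem
      exact hij (by rw [h1 i j]; simp [v, hmem])
    · by_contra hmem
      exact hij (by rw [h2 i j]; simp [h, hmem])
  · refine gridBoundary_adj_cases
      (P := fun x y => s(x, y) ∈ p.edges → (gridBoundary R').Adj x y)
      (fun x y hxy hyx => (hxy (Sym2.eq_swap ▸ hyx)).symm) (fun i j hij hmem => ?_)
      (fun i j hij hmem => ?_) (p.adj_of_mem_edges hxy) hxy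
    · rw [gridBoundary_adj_vertical, h1 i j]
      simp [v, hmem]
    · rw [gridBoundary_adj_horizontal, h2 i j]
      simp [h, hmem]

lemma eq_of_forall_not_gridBoundary_adj {R : ℤ × ℤ → ZMod 2}
    (h : ∀ x y, ¬ (gridBoundary R).Adj x y) (a b : ℤ × ℤ) : R a = R b := by
  have hv : ∀ i j, R (i, j) = R (i - 1, j) := fun i j => by
    simpa [gridBoundary_adj_vertical] using h (i, j) (i, j + 1)
  have hh : ∀ i j, R (i, j) = R (i, j - 1) := fun i j => by
    simpa [gridBoundary_adj_horizontal] using h (i, j) (i + 1, j)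
  have h1 : ∀ i j, R (i, j) = R (0, j) := fun i j => by
    induction i using Int.induction_on with
    | zero => rfl
    | succ i ih => rw [hv, add_sub_cancel_right, ih]
    | pred i ih => rw [← ih, hv (-i)]
  have h2 : ∀ j, R (0, j) = R (0, 0) := fun j => by
    induction j using Int.induction_on with
    | zero => rfl
    | succ i ih => rw [hh, add_sub_cancel_right, ih]
    | pred i ih => rw [← ih, hh 0 (-i)]
  rw [← Prod.mk.eta (p := a), ← Prod.mk.eta (p := b), h1, h2, h1 b.1, h2 b.2]

/-- If a labelling with finite boundary distinguishes two cells, then so does a labelling whose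
boundary is a single cycle contained in the original boundary. -/
lemma exists_isCycle_gridBoundary {R : ℤ × ℤ → ZMod 2} (hfin : (gridBoundary R).edgeSet.Finite)
    {a b : ℤ × ℤ} (hab : R a ≠ R b) :
    ∃ R' : ℤ × ℤ → ZMod 2, gridBoundary R' ≤ gridBoundary R ∧ R' a ≠ R' b ∧
      ∃ (u : ℤ × ℤ) (p : (gridBoundary R').Walk u u), p.IsCycle ∧
        ∀ x y, (gridBoundary R').Adj x y → s(x, y) ∈ p.edges := by
  induction hn : (gridBoundary R).edgeSet.ncard using Nat.strong_induction_on generalizing R with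
  | _ n ih =>
  obtain ⟨x, y, hxy⟩ : ∃ x y, (gridBoundary R).Adj x y := by
    by_contra! hcon
    exact hab (eq_of_forall_not_gridBoundary_adj hcon a b)
  have := hfin.to_subtype
  obtain ⟨u, p, hp⟩ := (gridBoundary R).exists_isCycle_of_forall_exists_adj_ne hxy
    fun _ _ => gridBoundary_exists_adj_ne
  obtain ⟨R', hR'⟩ := exists_gridBoundary_adj_iff_mem_edges hp
  have hle : gridBoundary R' ≤ gridBoundary R := fun x y h => p.adj_of_mem_edges ((hR' x y).1 h)
  by_cases hab' : R' a = R' b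
  · have key : ∀ c d c' d' : ZMod 2, c + c' ≠ d + d' ↔ ¬ (c ≠ d ↔ c' ≠ d') := by decide
    have hle' : ∀ x y, (gridBoundary (R + R')).Adj x y →
        (gridBoundary R).Adj x y ∧ ¬ (gridBoundary R').Adj x y := by
      intro x y hxy
      refine gridBoundary_adj_cases (P := fun x y =>
        (gridBoundary R).Adj x y ∧ ¬ (gridBoundary R').Adj x y)
        (fun x y h => by rwa [SimpleGraph.adj_comm, (gridBoundary R').adj_comm])
        (fun i j hij => ?_) (fun i j hij => ?_) hxy
      · have := @hle (i, j) (i, j + 1)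
        rw [gridBoundary_adj_vertical, gridBoundary_adj_vertical] at *
        have := (key _ _ _ _).1 hij
        tauto
      · have := @hle (i, j) (i + 1, j)
        rw [gridBoundary_adj_horizontal, gridBoundary_adj_horizontal] at *
        have := (key _ _ _ _).1 hij
        tauto
    have hss : (gridBoundary (R + R')).edgeSet ⊂ (gridBoundary R).edgeSet := by
      refine Set.ssubset_iff_of_subset ?_ |>.2 ⟨s(u, p.snd), p.adj_snd hp.not_nil, fun h => ?_⟩
      · exact SimpleGraph.edgeSet_mono fun x y h => (hle' x y h).1
      · exact (hle' _ _ h).2 ((hR' _ _).2 (p.mk_start_snd_mem_edges hp.not_nil))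
    obtain ⟨R'', h1, h2⟩ := ih _ (hn ▸ Set.ncard_lt_ncard hss hfin) (hfin.subset hss.1)
      (R := R + R') (by simpa [hab'] using hab) rfl
    exact ⟨R'', h1.trans fun x y h => (hle' x y h).1, h2⟩
  · have htr : ∀ e ∈ p.edges, e ∈ (gridBoundary R').edgeSet := by
      intro e he
      induction e with | _ x y => exact (hR' x y).2 he
    refine ⟨R', hle, hab', u, p.transfer _ htr, hp.transfer htr, fun x y h => ?_⟩
    rw [SimpleGraph.Walk.edges_transfer]
    exact (hR' x y).1 h

/-- The point at parameter `s` of the segment from `x` to `y`. -/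
def segmentPoint {E : Type*} [AddCommGroup E] [Module ℝ E] (x y : E) (s : ℝ) : E :=
  x + s • (y - x)

/-- The polygonal path visiting `v k` at time `k` for `k ≤ m`. -/
def polygonPath {E : Type*} [AddCommGroup E] [Module ℝ E] (v : ℕ → E) (m : ℕ) (t : ℝ) : E :=
  v 0 + ∑ j ∈ Finset.range m, max 0 (min (t - j) 1) • (v (j + 1) - v j)

section Polygon

variable {E : Type*} [AddCommGroup E] [Module ℝ E] (v : ℕ → E)

lemma polygonPath_of_le {m : ℕ} {t : ℝ} (h : m ≤ t) : polygonPath v m t = v m := by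
  induction m with
  | zero => simp [polygonPath]
  | succ m ih =>
    push_cast at h
    have := ih (by linarith)
    rw [polygonPath] at this ⊢
    rw [Finset.sum_range_succ, ← add_assoc, this, min_eq_right (by linarith), max_eq_right (by simp)]
    simp

lemma polygonPath_of_ge {m n : ℕ} (hmn : m ≤ n) {t : ℝ} (h : t ≤ m) :
    polygonPath v n t = polygonPath v m t := by
  induction n, hmn using Nat.le_induction with
  | base => rfl
  | succ n hn ih =>
    rw [← ih, polygonPath, polygonPath, Finset.sum_range_succ, max_eq_left]
    · simp
    · have : (m : ℝ) ≤ n := by exact_mod_cast hn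
      exact (min_le_left _ _).trans (by linarith)

lemma polygonPath_nat_add {m k : ℕ} (hk : k < m) {s : ℝ} (hs : s ∈ Icc (0 : ℝ) 1) :
    polygonPath v m (k + s) = segmentPoint (v k) (v (k + 1)) s := by
  rw [polygonPath_of_ge v (Nat.succ_le_of_lt hk) (by push_cast; linarith [hs.2])]
  have := polygonPath_of_le v (m := k) (t := k + s) (by linarith [hs.1])
  rw [polygonPath] at this ⊢
  rw [Finset.sum_range_succ, ← add_assoc, this, segmentPoint, add_sub_cancel_left,
    min_eq_left hs.2, max_eq_right hs.1]

lemma continuous_polygonPath [TopologicalSpace E] [IsTopologicalAddGroup E] [ContinuousSMul ℝ E]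
    (m : ℕ) : Continuous (polygonPath v m) := by
  unfold polygonPath
  fun_prop

lemma exists_nat_add_eq_of_mem_Ico {m : ℕ} {t : ℝ} (ht : t ∈ Ico (0 : ℝ) m) :
    ∃ k < m, ∃ s ∈ Ico (0 : ℝ) 1, t = k + s := by
  refine ⟨⌊t⌋₊, (Nat.floor_lt ht.1).2 ht.2, t - ⌊t⌋₊, ⟨?_, ?_⟩, by ring⟩
  · linarith [Nat.floor_le ht.1]
  · linarith [Nat.lt_floor_add_one t]

/-- A simple closed polygon is homeomorphic to the circle. -/
lemma nonempty_homeomorph_circle_of_closed_polygon [TopologicalSpace E] [T2Space E]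
    [IsTopologicalAddGroup E] [ContinuousSMul ℝ E] {m : ℕ} (hm : 0 < m) (hv : v m = v 0)
    (hinj : ∀ k < m, ∀ l < m, ∀ s ∈ Ico (0 : ℝ) 1, ∀ t ∈ Ico (0 : ℝ) 1,
      segmentPoint (v k) (v (k + 1)) s = segmentPoint (v l) (v (l + 1)) t → k = l ∧ s = t) :
    Nonempty ({z | ∃ k < m, ∃ s ∈ Icc (0 : ℝ) 1, z = segmentPoint (v k) (v (k + 1)) s}
      ≃ₜ Circle) := by
  have hm' : (0 : ℝ) < m := by exact_mod_cast hm
  have : Fact ((0 : ℝ) < m) := ⟨hm'⟩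
  have hends : polygonPath v m 0 = polygonPath v m m := by
    rw [polygonPath_of_le v le_rfl, hv, polygonPath_of_ge v (Nat.zero_le m) (by simp)]
    simp [polygonPath]
  let f : AddCircle (m : ℝ) → E := AddCircle.liftIco (m : ℝ) 0 (polygonPath v m)
  have hf : ∀ t ∈ Ico (0 : ℝ) m, f t = polygonPath v m t := fun t ht =>
    AddCircle.liftIco_zero_coe_apply ht
  have hsurj : ∀ x : AddCircle (m : ℝ), ∃ t ∈ Ico (0 : ℝ) m, (t : AddCircle (m : ℝ)) = x := by
    intro x
    have := AddCircle.coe_image_Ico_eq (m : ℝ) 0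
    rw [zero_add] at this
    exact (this ▸ mem_univ x : x ∈ _ '' Ico (0 : ℝ) m)
  have hcont : Continuous f :=
    AddCircle.liftIco_zero_continuous hends (continuous_polygonPath v m).continuousOn
  have hfinj : Injective f := by
    intro x y hxy
    obtain ⟨t, ht, rfl⟩ := hsurj x
    obtain ⟨t', ht', rfl⟩ := hsurj y
    rw [hf t ht, hf t' ht'] at hxy
    obtain ⟨k, hk, s, hs, rfl⟩ := exists_nat_add_eq_of_mem_Ico ht
    obtain ⟨l, hl, s', hs', rfl⟩ := exists_nat_add_eq_of_mem_Ico ht'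
    rw [polygonPath_nat_add v hk (Ico_subset_Icc_self hs),
      polygonPath_nat_add v hl (Ico_subset_Icc_self hs')] at hxy
    obtain ⟨rfl, rfl⟩ := hinj k hk l hl s hs s' hs' hxy
    rfl
  have hrange : range f =
      {z | ∃ k < m, ∃ s ∈ Icc (0 : ℝ) 1, z = segmentPoint (v k) (v (k + 1)) s} := by
    ext z
    constructor
    · rintro ⟨x, rfl⟩
      obtain ⟨t, ht, rfl⟩ := hsurj x
      rw [hf t ht]
      obtain ⟨k, hk, s, hs, rfl⟩ := exists_nat_add_eq_of_mem_Ico ht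
      exact ⟨k, hk, s, Ico_subset_Icc_self hs, polygonPath_nat_add v hk (Ico_subset_Icc_self hs)⟩
    · rintro ⟨k, hk, s, hs, rfl⟩
      rw [← polygonPath_nat_add v hk hs]
      have hk' : (k : ℝ) + 1 ≤ m := by exact_mod_cast hk
      have hk0 : (0 : ℝ) ≤ k := by positivity
      rcases eq_or_lt_of_le (show k + s ≤ m by linarith [hs.2]) with h | h
      · rw [h, ← hends, ← hf 0 ⟨le_rfl, hm'⟩]
        exact mem_range_self _
      · rw [← hf _ ⟨by linarith [hs.1], h⟩]
        exact mem_range_self _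
  have hemb : IsEmbedding f := (hcont.isClosedEmbedding hfinj).isEmbedding
  exact ⟨(Homeomorph.setCongr hrange.symm).trans <| hemb.toHomeomorph.symm.trans <|
    AddCircle.homeomorphCircle hm'.ne'⟩

end Polygon

/-- The embedding of the integer lattice in the plane. -/
def latticePoint (p : ℤ × ℤ) : ℝ × ℝ := (p.1, p.2)

lemma lattice_coordinate_eq {a b d e : ℤ} (hd : d = -1 ∨ d = 0 ∨ d = 1)
    (he : e = -1 ∨ e = 0 ∨ e = 1) {s t : ℝ} (hs : s ∈ Ico (0 : ℝ) 1) (ht : t ∈ Ico (0 : ℝ) 1)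
    (h : a + s * d = b + t * e) :
    (a = b ∧ s * d = t * e ∧ (d ≠ e → s * d = 0 ∧ t * e = 0)) ∨ (d = -e ∧ b = a + d) := by
  obtain ⟨hs0, hs1⟩ := hs
  obtain ⟨ht0, ht1⟩ := ht
  have h1 : (a : ℝ) < b + 2 := by
    rcases hd with rfl | rfl | rfl <;> rcases he with rfl | rfl | rfl <;> push_cast at h <;> linarith
  have h2 : (b : ℝ) < a + 2 := by
    rcases hd with rfl | rfl | rfl <;> rcases he with rfl | rfl | rfl <;> push_cast at h <;> linarith
  norm_cast at h1 h2
  obtain rfl | rfl | rfl : b = a - 1 ∨ b = a ∨ b = a + 1 := by lia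
  all_goals
    rcases hd with rfl | rfl | rfl <;> rcases he with rfl | rfl | rfl <;> push_cast at h <;>
      first
      | exact Or.inr ⟨by lia, by lia⟩
      | (exfalso; linarith)
      | exact Or.inl ⟨rfl, by push_cast; linarith, fun hne => by
          first
          | exact absurd rfl hne
          | (push_cast; constructor <;> linarith)⟩

/-- `q` is one of the four lattice neighbours of `p`. -/
def IsLatticeNeighbor (p q : ℤ × ℤ) : Prop :=
  (q = (p.1, p.2 + 1) ∨ q = (p.1 + 1, p.2)) ∨ (q = (p.1, p.2 - 1) ∨ q = (p.1 - 1, p.2))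

lemma isLatticeNeighbor_of_adj {R : ℤ × ℤ → ZMod 2} {p q : ℤ × ℤ}
    (h : (gridBoundary R).Adj p q) : IsLatticeNeighbor p q := by
  simp only [gridBoundary, SimpleGraph.fromRel_adj] at h
  unfold IsLatticeNeighbor
  grind

lemma lattice_segment_inj {x y x' y' : ℤ × ℤ} (h : IsLatticeNeighbor x y)
    (h' : IsLatticeNeighbor x' y') {s t : ℝ} (hs : s ∈ Ico (0 : ℝ) 1) (ht : t ∈ Ico (0 : ℝ) 1)
    (heq : segmentPoint (latticePoint x) (latticePoint y) s =
      segmentPoint (latticePoint x') (latticePoint y') t) :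
    (x = x' ∧ s = t) ∨ (x = y' ∧ y = x') := by
  obtain ⟨a, b⟩ := x
  obtain ⟨c, d⟩ := x'
  obtain ⟨e₁, e₂, rfl, he⟩ : ∃ e₁ e₂ : ℤ, y = (a + e₁, b + e₂) ∧
      ((e₁ = 0 ∧ (e₂ = 1 ∨ e₂ = -1)) ∨ (e₂ = 0 ∧ (e₁ = 1 ∨ e₁ = -1))) :=
    ⟨y.1 - a, y.2 - b, by simp, by unfold IsLatticeNeighbor at h; grind⟩
  obtain ⟨f₁, f₂, rfl, hf⟩ : ∃ f₁ f₂ : ℤ, y' = (c + f₁, d + f₂) ∧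
      ((f₁ = 0 ∧ (f₂ = 1 ∨ f₂ = -1)) ∨ (f₂ = 0 ∧ (f₁ = 1 ∨ f₁ = -1))) :=
    ⟨y'.1 - c, y'.2 - d, by simp, by unfold IsLatticeNeighbor at h'; grind⟩
  simp only [segmentPoint, latticePoint, Int.cast_add, Prod.mk_sub_mk, Prod.smul_mk,
    Prod.mk_add_mk, smul_eq_mul, Prod.mk.injEq, add_sub_cancel_left] at heq
  have h1 := lattice_coordinate_eq (by lia) (by lia) hs ht heq.1
  have h2 := lattice_coordinate_eq (by lia) (by lia) hs ht heq.2
  clear h h' heq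
  rcases he with ⟨rfl, rfl | rfl⟩ | ⟨rfl, rfl | rfl⟩ <;>
    rcases hf with ⟨rfl, rfl | rfl⟩ | ⟨rfl, rfl | rfl⟩ <;> norm_num at h1 h2 ⊢ <;> grind

/-- The closed unit cell with lower left corner `p`. -/
def closedCell (p : ℤ × ℤ) : Set (ℝ × ℝ) :=
  {z | z.1 ∈ Icc (p.1 : ℝ) (p.1 + 1) ∧ z.2 ∈ Icc (p.2 : ℝ) (p.2 + 1)}

/-- The cell containing a given point. -/
noncomputable def cellOf (z : ℝ × ℝ) : ℤ × ℤ := (⌊z.1⌋, ⌊z.2⌋)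

lemma mem_closedCell_cellOf (z : ℝ × ℝ) : z ∈ closedCell (cellOf z) :=
  ⟨⟨Int.floor_le _, (Int.lt_floor_add_one _).le⟩, ⟨Int.floor_le _, (Int.lt_floor_add_one _).le⟩⟩

lemma dist_le_one_of_mem_closedCell {p : ℤ × ℤ} {z w : ℝ × ℝ} (hz : z ∈ closedCell p)
    (hw : w ∈ closedCell p) : dist z w ≤ 1 := by
  obtain ⟨⟨h1, h2⟩, h3, h4⟩ := hz
  obtain ⟨⟨h5, h6⟩, h7, h8⟩ := hw
  rw [Prod.dist_eq, max_le_iff, Real.dist_eq, Real.dist_eq, abs_le, abs_le]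
  refine ⟨⟨?_, ?_⟩, ?_, ?_⟩ <;> linarith

lemma segmentPoint_symm {E : Type*} [AddCommGroup E] [Module ℝ E] (x y : E) (s : ℝ) :
    segmentPoint y x s = segmentPoint x y (1 - s) := by
  unfold segmentPoint
  module

/-- Each boundary edge lies in two closed cells with different labels. -/
lemma exists_closedCell_of_adj {R : ℤ × ℤ → ZMod 2} {x y : ℤ × ℤ} (h : (gridBoundary R).Adj x y)
    {s : ℝ} (hs : s ∈ Icc (0 : ℝ) 1) :
    ∃ p q, R p ≠ R q ∧ segmentPoint (latticePoint x) (latticePoint y) s ∈ closedCell p ∧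
      segmentPoint (latticePoint x) (latticePoint y) s ∈ closedCell q := by
  refine gridBoundary_adj_cases (P := fun x y => ∀ s ∈ Icc (0 : ℝ) 1,
    ∃ p q, R p ≠ R q ∧ segmentPoint (latticePoint x) (latticePoint y) s ∈ closedCell p ∧
      segmentPoint (latticePoint x) (latticePoint y) s ∈ closedCell q) ?_ ?_ ?_ h s hs
  · intro x y hxy s hs
    rw [segmentPoint_symm]
    exact hxy (1 - s) ⟨by linarith [hs.2], by linarith [hs.1]⟩
  · intro i j hij s hs
    refine ⟨_, _, hij, ?_, ?_⟩ <;> simp [segmentPoint, latticePoint, closedCell, hs.1, hs.2]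
  · intro i j hij s hs
    refine ⟨_, _, hij, ?_, ?_⟩ <;> simp [segmentPoint, latticePoint, closedCell, hs.1, hs.2]

lemma finite_edgeSet_gridBoundary {R : ℤ × ℤ → ZMod 2} {N : ℤ}
    (hR : ∀ p, R p ≠ 0 → p ∈ Icc (-N) N ×ˢ Icc (-N) N) : (gridBoundary R).edgeSet.Finite := by
  let B : Set (ℤ × ℤ) := Icc (-N - 1) (N + 1) ×ˢ Icc (-N - 1) (N + 1)
  have hB : B.Finite := (Set.finite_Icc _ _).prod (Set.finite_Icc _ _)
  refine ((hB.prod hB).image fun e => s(e.1, e.2)).subset fun e he => ?_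
  induction e with | _ x y =>
  have hne : ∀ p q, R p ≠ R q → R p ≠ 0 ∨ R q ≠ 0 := by grind
  have key : x ∈ B ∧ y ∈ B := by
    refine gridBoundary_adj_cases (P := fun x y => x ∈ B ∧ y ∈ B) (fun x y h => h.symm)
      (fun i j hij => ?_) (fun i j hij => ?_) he
    all_goals
      simp only [B, mem_prod, mem_Icc] at hR ⊢
      rcases hne _ _ hij with h | h <;> have := hR _ h <;> grind
  exact ⟨(x, y), key, rfl⟩

lemma eventually_floor_eq (z : ℝ) :
    ∀ᶠ y in 𝓝 z, ⌊y⌋ = ⌊z⌋ ∨ (⌊y⌋ = ⌊z⌋ - 1 ∧ z = ⌊z⌋) := by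
  rcases (Int.floor_le z).eq_or_lt with h | h
  · filter_upwards [Ioo_mem_nhds (show (⌊z⌋ : ℝ) - 1 < z by linarith) (Int.lt_floor_add_one z)]
      with y hy
    rcases lt_or_ge y ⌊z⌋ with hyz | hyz
    · refine Or.inr ⟨Int.floor_eq_iff.2 ⟨?_, ?_⟩, h.symm⟩ <;> push_cast <;> linarith [hy.1]
    · exact Or.inl (Int.floor_eq_iff.2 ⟨hyz, hy.2⟩)
  · filter_upwards [Ioo_mem_nhds h (Int.lt_floor_add_one z)] with y hy
    exact Or.inl (Int.floor_eq_iff.2 ⟨hy.1.le, hy.2⟩)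

/-- Off the boundary edges, the label of the cell of a point is locally constant. -/
lemma eventually_label_eq {R : ℤ × ℤ → ZMod 2} {z : ℝ × ℝ}
    (hz : ∀ x y, (gridBoundary R).Adj x y → ∀ s ∈ Icc (0 : ℝ) 1,
      z ≠ segmentPoint (latticePoint x) (latticePoint y) s) :
    ∀ᶠ w in 𝓝 z, R (cellOf w) = R (cellOf z) := by
  have hvert : ∀ j : ℤ, z.1 = ⌊z.1⌋ → z.2 ∈ Icc (j : ℝ) (j + 1) →
      R (⌊z.1⌋, j) = R (⌊z.1⌋ - 1, j) := by
    intro j h1 h2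
    by_contra hne
    refine hz _ _ ((gridBoundary_adj_vertical R _ _).2 hne) (z.2 - j)
      ⟨by linarith [h2.1], by linarith [h2.2]⟩ ?_
    ext <;> simp [segmentPoint, latticePoint, ← h1]
  have hhoriz : z.2 = ⌊z.2⌋ → R (⌊z.1⌋, ⌊z.2⌋) = R (⌊z.1⌋, ⌊z.2⌋ - 1) := by
    intro h2
    by_contra hne
    refine hz _ _ ((gridBoundary_adj_horizontal R _ _).2 hne) (z.1 - ⌊z.1⌋)
      ⟨by linarith [Int.floor_le z.1], by linarith [Int.lt_floor_add_one z.1]⟩ ?_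
    ext <;> simp [segmentPoint, latticePoint, ← h2]
  have h1 : ∀ᶠ w in 𝓝 z, ⌊w.1⌋ = ⌊z.1⌋ ∨ (⌊w.1⌋ = ⌊z.1⌋ - 1 ∧ z.1 = ⌊z.1⌋) :=
    continuous_fst.continuousAt.eventually (eventually_floor_eq z.1)
  have h2 : ∀ᶠ w in 𝓝 z, ⌊w.2⌋ = ⌊z.2⌋ ∨ (⌊w.2⌋ = ⌊z.2⌋ - 1 ∧ z.2 = ⌊z.2⌋) :=
    continuous_snd.continuousAt.eventually (eventually_floor_eq z.2)
  have hfl := Int.floor_le z.2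
  have hlt := Int.lt_floor_add_one z.2
  filter_upwards [h1, h2] with w hw1 hw2
  unfold cellOf
  rcases hw2 with hw2 | ⟨hw2, hz2⟩
  · rw [hw2]
    rcases hw1 with hw1 | ⟨hw1, hz1⟩
    · rw [hw1]
    · rw [hw1, hvert _ hz1 ⟨hfl, hlt.le⟩]
  · rw [hw2, hhoriz hz2]
    rcases hw1 with hw1 | ⟨hw1, hz1⟩
    · rw [hw1]
    · rw [hw1, hvert (⌊z.2⌋ - 1) hz1 (by push_cast; constructor <;> linarith)]

/-- A cycle in a grid graph traces a set homeomorphic to the circle. -/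
lemma nonempty_homeomorph_circle_of_isCycle {R : ℤ × ℤ → ZMod 2} {u : ℤ × ℤ}
    {p : (gridBoundary R).Walk u u} (hp : p.IsCycle) :
    Nonempty ({z | ∃ k < p.length, ∃ s ∈ Icc (0 : ℝ) 1,
      z = segmentPoint (latticePoint (p.getVert k)) (latticePoint (p.getVert (k + 1))) s}
        ≃ₜ Circle) := by
  have hlen := hp.three_le_length
  refine nonempty_homeomorph_circle_of_closed_polygon (fun k => latticePoint (p.getVert k))
    (by lia) (by simp) fun k hk l hl s hs t ht h => ?_
  have hinj : ∀ k l, k < p.length → l < p.length → p.getVert k = p.getVert l → k = l :=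
    fun k l hk hl h => hp.getVert_injOn' (by simp only [mem_ofPred_eq]; lia)
      (by simp only [mem_ofPred_eq]; lia) h
  have hinj' : ∀ k l, k < p.length → l < p.length → p.getVert k = p.getVert (l + 1) →
      k = l + 1 ∨ (k = 0 ∧ l + 1 = p.length) := by
    intro k l hk hl h
    rcases (show l + 1 < p.length ∨ l + 1 = p.length by lia) with hl' | hl'
    · exact Or.inl (hinj _ _ hk hl' h)
    · refine Or.inr ⟨hinj _ _ hk (by lia) ?_, hl'⟩
      rw [h, hl', p.getVert_length, p.getVert_zero]
  rcases lattice_segment_inj (isLatticeNeighbor_of_adj (p.adj_getVert_succ hk))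
    (isLatticeNeighbor_of_adj (p.adj_getVert_succ hl)) hs ht h with ⟨h1, h2⟩ | ⟨h1, h2⟩
  · exact ⟨hinj k l hk hl h1, h2⟩
  · have := hinj' k l hk hl h1
    have := hinj' l k hl hk h2.symm
    lia

/-- Sets at distance more than one in the sup metric are separated by a simple closed curve. -/
lemma exists_separating_circle_of_one_lt_dist {K₁ K₂ : Set (ℝ × ℝ)}
    (hb : Bornology.IsBounded K₁) (hd : ∀ x ∈ K₁, ∀ y ∈ K₂, 1 < dist x y) {a b : ℝ × ℝ}
    (ha : a ∈ K₁) (hb' : b ∈ K₂) :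
    ∃ J : Set (ℝ × ℝ), Nonempty (J ≃ₜ Circle) ∧ Disjoint J (K₁ ∪ K₂) ∧
      ∀ T ⊆ Jᶜ, IsPreconnected T → a ∈ T → b ∉ T := by
  classical
  let R : ℤ × ℤ → ZMod 2 := fun p => if (K₁ ∩ closedCell p).Nonempty then 1 else 0
  have hR : ∀ p, R p ≠ 0 ↔ (K₁ ∩ closedCell p).Nonempty := by
    intro p
    simp only [R]
    split_ifs with h <;> simp [h]
  have hR1 : ∀ p q, R p ≠ R q → R p ≠ 0 ∨ R q ≠ 0 := fun p q h => by
    by_contra! hcon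
    exact h (hcon.1.trans hcon.2.symm)
  have hR2 : ∀ p q, R p ≠ R q → R p = 0 ∨ R q = 0 := fun p q h => by
    simp only [R] at h ⊢
    split_ifs at h ⊢ <;> simp_all
  have hfin : (gridBoundary R).edgeSet.Finite := by
    obtain ⟨C, hC⟩ := hb.subset_closedBall 0
    obtain ⟨N, hN⟩ := exists_int_gt C
    refine finite_edgeSet_gridBoundary (N := N + 1) fun p hp => ?_
    obtain ⟨x, hx, h1, h2⟩ := (hR p).1 hp
    have := hC hx
    rw [mem_closedBall_zero_iff, Prod.norm_def, max_le_iff, Real.norm_eq_abs, Real.norm_eq_abs,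
      abs_le, abs_le] at this
    have e1 : -(N : ℝ) < p.1 + 1 := by linarith [h1.2]
    have e2 : (p.1 : ℝ) < N := by linarith [h1.1]
    have e3 : -(N : ℝ) < p.2 + 1 := by linarith [h2.2]
    have e4 : (p.2 : ℝ) < N := by linarith [h2.1]
    norm_cast at e1 e2 e3 e4
    simp only [mem_prod, mem_Icc]
    lia
  have hab : R (cellOf a) ≠ R (cellOf b) := by
    have h1 : R (cellOf a) = 1 := if_pos ⟨a, ha, mem_closedCell_cellOf a⟩
    have h2 : R (cellOf b) = 0 := if_neg fun ⟨x, hx, hx'⟩ =>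
      (hd x hx b hb').not_ge (dist_le_one_of_mem_closedCell hx' (mem_closedCell_cellOf b))
    rw [h1, h2]
    exact one_ne_zero
  obtain ⟨R', hle, hab', u, p, hp, hedge⟩ := exists_isCycle_gridBoundary hfin hab
  refine ⟨_, nonempty_homeomorph_circle_of_isCycle hp, ?_, ?_⟩
  · rw [Set.disjoint_left]
    rintro _ ⟨k, hk, s, hs, rfl⟩
    obtain ⟨c, c', hc, hzc, hzc'⟩ := exists_closedCell_of_adj (hle (p.adj_getVert_succ hk)) hs
    rintro (h | h)
    · rcases hR2 _ _ hc with h0 | h0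
      · exact (hR c).2 ⟨_, h, hzc⟩ h0
      · exact (hR c').2 ⟨_, h, hzc'⟩ h0
    · rcases hR1 _ _ hc with h0 | h0
      · obtain ⟨x, hx, hx'⟩ := (hR c).1 h0
        exact (hd x hx _ h).not_ge (dist_le_one_of_mem_closedCell hx' hzc)
      · obtain ⟨x, hx, hx'⟩ := (hR c').1 h0
        exact (hd x hx _ h).not_ge (dist_le_one_of_mem_closedCell hx' hzc')
  · intro T hT hTc haT hbT
    let _ : TopologicalSpace (ZMod 2) := ⊥
    have : DiscreteTopology (ZMod 2) := ⟨rfl⟩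
    refine hab' (hTc.constant (f := fun z => R' (cellOf z)) (fun z hz => ?_) haT hbT)
    refine ContinuousAt.continuousWithinAt ?_
    refine continuousAt_const.congr (f := fun _ => R' (cellOf z)) ?_
    refine (eventually_label_eq fun x y hxy s hs hzs => hT hz ?_).mono fun w hw => hw.symm
    obtain ⟨k, hk, hk'⟩ := p.mk_mem_edges_iff_exists.1 (hedge x y hxy)
    rcases Sym2.eq_iff.1 hk' with ⟨rfl, rfl⟩ | ⟨rfl, rfl⟩
    · exact ⟨k, hk, s, hs, hzs⟩
    · exact ⟨k, hk, 1 - s, ⟨by linarith [hs.2], by linarith [hs.1]⟩, by rw [hzs, segmentPoint_symm]⟩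

lemma isJordanCurve_of_homeomorph_circle {J : Set (EuclideanSpace ℝ (Fin 2))}
    (h : Nonempty (J ≃ₜ Circle)) : IsJordanCurve J := by
  obtain ⟨e⟩ := h
  let φ := Complex.orthonormalBasisOneI.repr
  have himg : φ.toHomeomorph '' sphere (0 : ℂ) 1 = sphere (0 : EuclideanSpace ℝ (Fin 2)) 1 := by
    have := φ.image_sphere 0 1
    rwa [map_zero] at this
  exact ⟨e.trans ((φ.toHomeomorph.image (sphere (0 : ℂ) 1)).trans (Homeomorph.setCongr himg))⟩

/-- Two disjoint compact sets in the plane are separated by a Jordan curve avoiding both. -/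
lemma exists_separating_jordanCurve {K₁ K₂ : Set (EuclideanSpace ℝ (Fin 2))} (h₁ : IsCompact K₁)
    (h₂ : IsCompact K₂) (hd : Disjoint K₁ K₂) {a b : EuclideanSpace ℝ (Fin 2)} (ha : a ∈ K₁)
    (hb : b ∈ K₂) :
    ∃ J, IsJordanCurve J ∧ Disjoint J (K₁ ∪ K₂) ∧
      ∀ T ⊆ Jᶜ, IsPreconnected T → a ∈ T → b ∉ T := by
  let g : EuclideanSpace ℝ (Fin 2) ≃ₜ ℝ × ℝ :=
    (EuclideanSpace.equiv (Fin 2) ℝ).toHomeomorph.trans (Homeomorph.piFinTwo fun _ => ℝ)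
  obtain ⟨r, hr, hrd⟩ := Metric.exists_pos_forall_lt_edist (h₁.image g.continuous)
    (h₂.image g.continuous).isClosed ((disjoint_image_iff g.injective).2 hd)
  have hr' : (0 : ℝ) < r := hr
  let f : EuclideanSpace ℝ (Fin 2) ≃ₜ ℝ × ℝ :=
    g.trans (Homeomorph.smulOfNeZero (r : ℝ)⁻¹ (inv_ne_zero hr'.ne'))
  have hdist : ∀ x ∈ f '' K₁, ∀ y ∈ f '' K₂, 1 < dist x y := by
    rintro _ ⟨x, hx, rfl⟩ _ ⟨y, hy, rfl⟩
    have h1 := hrd _ (mem_image_of_mem g hx) _ (mem_image_of_mem g hy)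
    rw [edist_nndist, ENNReal.coe_lt_coe, ← NNReal.coe_lt_coe, coe_nndist] at h1
    change 1 < dist ((r : ℝ)⁻¹ • g x) ((r : ℝ)⁻¹ • g y)
    rw [dist_smul₀, norm_inv, Real.norm_of_nonneg hr'.le]
    exact (lt_inv_mul_iff₀ hr').2 (by simpa using h1)
  obtain ⟨J, ⟨e⟩, hJ, hsep⟩ := exists_separating_circle_of_one_lt_dist
    (h₁.image f.continuous).isBounded hdist (mem_image_of_mem f ha) (mem_image_of_mem f hb)
  refine ⟨f.symm '' J, isJordanCurve_of_homeomorph_circle ⟨(f.symm.image J).symm.trans e⟩, ?_, ?_⟩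
  · rw [← disjoint_image_iff f.injective, image_union, f.image_symm, f.image_preimage]
    exact hJ
  · intro T hT hTc haT hbT
    refine hsep (f '' T) ?_ (hTc.image f f.continuous.continuousOn) (mem_image_of_mem f haT)
      (mem_image_of_mem f hbT)
    rintro _ ⟨z, hz, rfl⟩ hzJ
    exact hT hz ⟨f z, hzJ, f.symm_apply_apply z⟩

lemma isPreconnected_compl_closedBall_zero {E : Type*} [NormedAddCommGroup E] [NormedSpace ℝ E]
    (h : 1 < Module.rank ℝ E) {r : ℝ} (hr : 0 ≤ r) :
    IsPreconnected (closedBall (0 : E) r)ᶜ := by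
  have himg : (fun p : ℝ × E => p.1 • p.2) '' (Ioi r ×ˢ sphere (0 : E) 1) =
      (closedBall (0 : E) r)ᶜ := by
    ext x
    simp only [mem_image, mem_prod, mem_Ioi, mem_sphere_zero_iff_norm, mem_compl_iff,
      mem_closedBall_zero_iff, not_le, Prod.exists]
    constructor
    · rintro ⟨t, y, ⟨ht, hy⟩, rfl⟩
      rwa [norm_smul, hy, mul_one, Real.norm_of_nonneg (hr.trans ht.le)]
    · intro hx
      have hx0 : ‖x‖ ≠ 0 := (hr.trans_lt hx).ne'
      exact ⟨‖x‖, ‖x‖⁻¹ • x, ⟨hx, by simp [norm_smul, hx0]⟩, smul_inv_smul₀ hx0 x⟩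
  rw [← himg]
  exact (isPreconnected_Ioi.prod (isPreconnected_sphere h 0 1)).image _
    (continuous_smul.continuousOn)

/-- If a bounded set `J` separates two points, then one of their components in the complement of
`J` is bounded. -/
lemma isBounded_connectedComponentIn_or {E : Type*} [NormedAddCommGroup E] [NormedSpace ℝ E]
    (h : 1 < Module.rank ℝ E) {J : Set E} (hJ : Bornology.IsBounded J) {a b : E} (ha : a ∉ J)
    (hsep : ∀ T ⊆ Jᶜ, IsPreconnected T → a ∈ T → b ∉ T) (hb : b ∉ J) :
    Bornology.IsBounded (connectedComponentIn Jᶜ a) ∨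
      Bornology.IsBounded (connectedComponentIn Jᶜ b) := by
  by_contra! hcon
  obtain ⟨r, hr, hJr⟩ := hJ.subset_closedBall_lt 0 0
  have hfar : ∀ c : E, ¬ Bornology.IsBounded (connectedComponentIn Jᶜ c) →
      ∃ x ∈ connectedComponentIn Jᶜ c, x ∈ (closedBall (0 : E) r)ᶜ := by
    intro c hc
    by_contra! hx
    exact hc (isBounded_closedBall.subset fun x hxc => not_not.1 (hx x hxc))
  obtain ⟨x, hxa, hx⟩ := hfar a hcon.1
  obtain ⟨y, hyb, hy⟩ := hfar b hcon.2
  have hconn := isPreconnected_compl_closedBall_zero h hr.le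
  have h1 := isPreconnected_connectedComponentIn.union x hxa hx hconn
  have h2 := h1.union y (Or.inr hy) hyb isPreconnected_connectedComponentIn
  refine hsep _ (union_subset (union_subset (connectedComponentIn_subset _ _)
    (compl_subset_compl.2 hJr)) (connectedComponentIn_subset _ _)) h2
    (Or.inl (Or.inl (mem_connectedComponentIn ha))) (Or.inr (mem_connectedComponentIn hb))

lemma one_lt_rank_euclideanPlane : 1 < Module.rank ℝ (EuclideanSpace ℝ (Fin 2)) := by
  rw [← Module.finrank_eq_rank, finrank_euclideanSpace_fin]
  norm_num

lemma IsJordanCurve.isCompact {J : Set (EuclideanSpace ℝ (Fin 2))} (hJ : IsJordanCurve J) :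
    IsCompact J := by
  obtain ⟨e⟩ := hJ
  exact isCompact_iff_compactSpace.2 e.symm.compactSpace

lemma IsJordanCurve.isPreconnected {J : Set (EuclideanSpace ℝ (Fin 2))} (hJ : IsJordanCurve J) :
    IsPreconnected J := by
  obtain ⟨e⟩ := hJ
  have := isPreconnected_iff_preconnectedSpace.1
    (isPreconnected_sphere one_lt_rank_euclideanPlane (0 : EuclideanSpace ℝ (Fin 2)) 1)
  exact isPreconnected_iff_preconnectedSpace.2 (e.symm.surjective.denseRange.preconnectedSpace
    e.symm.continuous)

/-- No point of the frontier of a set without holes is enclosed by a Jordan curve in the set. -/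
lemma HasNoHole.notMem_frontier_of_isBounded {A J : Set (EuclideanSpace ℝ (Fin 2))}
    (hA : HasNoHole A) (hJ : IsJordanCurve J) (hJA : J ⊆ A) {c : EuclideanSpace ℝ (Fin 2)}
    (hc : c ∉ J) (hbdd : Bornology.IsBounded (connectedComponentIn Jᶜ c)) : c ∉ frontier A := by
  have hopen : IsOpen (connectedComponentIn Jᶜ c) :=
    hJ.isCompact.isClosed.isOpen_compl.connectedComponentIn
  have hsub : connectedComponentIn Jᶜ c ⊆ A := fun x hx => hA J hJA hJ
    ⟨connectedComponentIn_subset _ _ hx, connectedComponentIn_eq hx ▸ hbdd⟩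
  exact fun hfr => hfr.2 (interior_maximal hsub hopen (mem_connectedComponentIn hc))

/-- The frontier of a plane continuum without holes is connected. -/
lemma HasNoHole.isConnected_frontier {A : Set (EuclideanSpace ℝ (Fin 2))} (hA : HasNoHole A)
    (hcomp : IsCompact A) (hconn : IsConnected A) : IsConnected (frontier A) := by
  have hfr : frontier A ⊆ A := hcomp.isClosed.frontier_subset
  have hfrc : IsCompact (frontier A) := hcomp.of_isClosed_subset isClosed_frontier hfr
  refine ⟨nonempty_frontier_iff.2 ⟨hconn.nonempty, hcomp.ne_univ⟩, ?_⟩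
  rw [isPreconnected_closed_iff]
  rintro t t' ht ht' hcov ⟨a, ha, hat⟩ ⟨b, hb, hbt'⟩
  by_contra hne
  obtain ⟨J, hJ, hdisj, hsep⟩ := exists_separating_jordanCurve (hfrc.inter_right ht)
    (hfrc.inter_right ht') (Set.disjoint_left.2 fun x hx hx' => hne ⟨x, hx.1, hx.2, hx'.2⟩)
    ⟨ha, hat⟩ ⟨hb, hbt'⟩
  rw [← inter_union_distrib_left, inter_eq_left.2 hcov] at hdisj
  have haJ : a ∉ J := fun h => Set.disjoint_left.1 hdisj h ha
  have hbJ : b ∉ J := fun h => Set.disjoint_left.1 hdisj h hb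
  by_cases hJA : J ⊆ A
  · rcases isBounded_connectedComponentIn_or one_lt_rank_euclideanPlane hJ.isCompact.isBounded haJ
      hsep hbJ with h | h
    · exact hA.notMem_frontier_of_isBounded hJ hJA haJ h ha
    · exact hA.notMem_frontier_of_isBounded hJ hJA hbJ h hb
  · obtain ⟨x, hx, hxA⟩ := not_subset.1 hJA
    refine hsep A (fun z hz hzJ => ?_) hconn.isPreconnected (hfr ha) (hfr hb)
    have hmem : ∀ w ∈ J, w ∈ A → w ∈ interior A := fun w hwJ hwA => by_contra fun hw =>
      Set.disjoint_left.1 hdisj hwJ ⟨subset_closure hwA, hw⟩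
    obtain ⟨w, -, hw, hw'⟩ := hJ.isPreconnected (interior A) Aᶜ isOpen_interior
      hcomp.isClosed.isOpen_compl (fun w hw => (em (w ∈ A)).imp_left (hmem w hw))
      ⟨z, hzJ, hmem z hzJ hz⟩ ⟨x, hx, hxA⟩
    exact hw' (interior_subset hw)

theorem frontier_of_attractor_connected
    (n : ℕ) (E : Type) [Fintype E] (src tgt : E → Fin n)
    (S : E → EuclideanSpace ℝ (Fin 2) → EuclideanSpace ℝ (Fin 2))
    (hout : ∀ i : Fin n, ∃ e : E, src e = i)
    (hinj : ∀ e, Function.Injective (S e))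
    (hcontr : ∀ e : E, ∃ r : NNReal, r < 1 ∧ LipschitzWith r (S e))
    (hsc : ∀ i j : Fin n, ∃ p : List E, p ≠ [] ∧ IsPathFrom src tgt i j p)
    -- the open set condition
    (O : Fin n → Set (EuclideanSpace ℝ (Fin 2)))
    (hOne : ∀ k, (O k).Nonempty) (hOopen : ∀ k, IsOpen (O k))
    (hObdd : ∀ k, Bornology.IsBounded (O k))
    (hOsub : ∀ i, (⋃ (e : E) (_ : src e = i), S e '' O (tgt e)) ⊆ O i)
    (hOdisj : ∀ e e' : E, src e = src e' → e ≠ e' →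
      Disjoint (S e '' O (tgt e)) (S e' '' O (tgt e')))
    -- the attractor, all components connected
    (A : Fin n → Set (EuclideanSpace ℝ (Fin 2)))
    (hAcp : ∀ i, IsCompact (A i)) (hAne : ∀ i, (A i).Nonempty)
    (hAconn : ∀ i, IsConnected (A i))
    (hattr : ∀ i, A i = ⋃ (e : E) (_ : src e = i), S e '' A (tgt e))
    (hAint : ∀ i, (interior (A i)).Nonempty)
    (hnohole : ∀ i, HasNoHole (A i)) :
    ∀ i : Fin n, IsConnected (frontier (A i)) := by
  exact fun i => (hnohole i).isConnected_frontier (hAcp i) (hAconn i)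
end
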